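/- Let X be a closed subset of Z × K, where Z is a zero-dimensional separable metrizable space and K is a compact metrizable space. Then dim X = 0 if and only if dim X(z) = 0 for every z ∈ Z. In particular, if Z is analytic then F₀(X) is Π¹₁ (co-analytic) in F(X). -/

import Mathlib

open Set Filter Topology TopologicalSpace

/-- `DimLE X n` : the topological (covering) dimension of `X` is at most `n`, i.e. every
finite open cover of `X` admits an open shrinking (refinement) of order at most `n + 1`. -/
def DimLE (X : Type*) [TopologicalSpace X] (n : ℕ) : Prop :=
  ∀ (k : ℕ) (U : Fin k → Set X), (∀ i, IsOpen (U i)) → (⋃ i, U i) = Set.univ →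
    ∃ V : Fin k → Set X, (∀ i, IsOpen (V i)) ∧ (∀ i, V i ⊆ U i) ∧ (⋃ i, V i) = Set.univ ∧
      ∀ x : X, ({i | x ∈ V i}).ncard ≤ n + 1

/-- The collection `F(X)` of closed subsets of `X`. -/
abbrev Cl (X : Type*) [TopologicalSpace X] : Type _ := {F : Set X // IsClosed F}

/-- `F₀(X)` : the set of all closed zero-dimensional subsets of `X`. -/
def F0 (X : Type*) [TopologicalSpace X] : Set (Cl X) := {F | DimLE (↥F.1) 0}

/-- The Vietoris topology on subsets of `Y`. -/
def vietoris (Y : Type*) [TopologicalSpace Y] : TopologicalSpace (Set Y) :=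
  TopologicalSpace.generateFrom
    ({S | ∃ U : Set Y, IsOpen U ∧ S = {A : Set Y | A ⊆ U}} ∪
     {S | ∃ U : Set Y, IsOpen U ∧ S = {A : Set Y | (A ∩ U).Nonempty}})

/-- A topology `τ` on `F(X)` is admissible if it is induced, via `F ↦ closure (e '' F)`,
by the Vietoris topology on some metrizable compactification `Y` of `X` (with embedding `e`). -/
def IsAdmissible (X : Type*) [tX : TopologicalSpace X] (τ : TopologicalSpace (Cl X)) : Prop :=
  ∃ (Y : Type) (tY : TopologicalSpace Y) (_ : @CompactSpace Y tY)
    (_ : @TopologicalSpace.MetrizableSpace Y tY) (e : X → Y),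
      @Topology.IsEmbedding X Y tX tY e ∧
      τ = (@vietoris Y tY).induced (fun F : Cl X => @closure Y tY (e '' F.1))

/-- An analytic space: a separable metrizable space which is empty or a continuous image
of the Baire space `ℕ → ℕ`. -/
def IsAnalyticSpace (X : Type*) [TopologicalSpace X] : Prop :=
  TopologicalSpace.MetrizableSpace X ∧ TopologicalSpace.SeparableSpace X ∧
    (IsEmpty X ∨ ∃ f : (ℕ → ℕ) → X, Continuous f ∧ Function.Surjective f)

/-- `Σ¹₂` subsets of a topological space: projections of co-analytic sets. -/
def IsSigma12 {W : Type*} [TopologicalSpace W] (s : Set W) : Prop :=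
  ∃ B : Set (W × (ℕ → ℕ)), MeasureTheory.AnalyticSet Bᶜ ∧ s = {w | ∃ y, (w, y) ∈ B}

/-- `Σ¹₂`-hardness (with Cantor space `2^ω = ℕ → Bool` as source). -/
def Sigma12Hard {W : Type*} [TopologicalSpace W] (A : Set W) : Prop :=
  ∀ A' : Set (ℕ → Bool), IsSigma12 A' →
    ∃ φ : (ℕ → Bool) → W, Continuous φ ∧ A' = φ ⁻¹' A

/-- `Π¹₁`-hardness. -/
def Pi11Hard {W : Type*} [TopologicalSpace W] (A : Set W) : Prop :=
  ∀ A' : Set (ℕ → Bool), MeasureTheory.AnalyticSet A'ᶜ →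
    ∃ φ : (ℕ → Bool) → W, Continuous φ ∧ A' = φ ⁻¹' A

/-- The additive Borel classes `Σ⁰ξ` : `Σ⁰₁` consists of the open sets, and for `ξ > 1`,
`Σ⁰ξ` consists of countable unions of sets whose complements are in some `Σ⁰η`, `η < ξ`. -/
inductive SigmaOrd {W : Type*} [TopologicalSpace W] : Ordinal.{0} → Set W → Prop
  | basic (s : Set W) : IsOpen s → SigmaOrd 1 s
  | union (ξ : Ordinal.{0}) (η : ℕ → Ordinal.{0}) (f : ℕ → Set W) (hξ : 1 < ξ)
      (hη : ∀ n, η n < ξ) (h : ∀ n, SigmaOrd (η n) (f n)ᶜ) : SigmaOrd ξ (⋃ n, f n)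

/-- The run produced when player I follows the strategy `σ` and player II plays `β`. -/
def playI (σ : List ℕ → ℕ) (β : ℕ → ℕ) : ℕ → ℕ := fun n =>
  if n % 2 = 0 then σ (List.ofFn fun i : Fin (n / 2) => β i) else β (n / 2)

/-- Player I has a winning strategy in the game `G_A`. -/
def PlayerIWins (A : Set (ℕ → ℕ)) : Prop :=
  ∃ σ : List ℕ → ℕ, ∀ β : ℕ → ℕ, playI σ β ∈ A

/-- The game operator `Game B` applied to `B ⊆ W × ω^ω`. -/
def GameOp {W : Type*} (B : Set (W × (ℕ → ℕ))) : Set W :=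
  {w | PlayerIWins {γ | (w, γ) ∈ B}}

/-- `Game Σ⁰ξ`-hardness. -/
def GameSigmaHard (ξ : Ordinal.{0}) {W : Type*} [TopologicalSpace W] (A : Set W) : Prop :=
  ∀ A' : Set (ℕ → Bool),
    (∃ B : Set ((ℕ → Bool) × (ℕ → ℕ)), SigmaOrd ξ B ∧ A' = GameOp B) →
    ∃ φ : (ℕ → Bool) → W, Continuous φ ∧ A' = φ ⁻¹' A

open scoped Function

section ZeroDimensional

variable {X : Type*} [TopologicalSpace X]

theorem dimLE_zero_iff : DimLE X 0 ↔
    ∀ (k : ℕ) (U : Fin k → Set X), (∀ i, IsOpen (U i)) → (⋃ i, U i) = univ →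
      ∃ V : Fin k → Set X, (∀ i, IsOpen (V i)) ∧ (∀ i, V i ⊆ U i) ∧ (⋃ i, V i) = univ ∧
        Pairwise (Disjoint on V) := by
  have key : ∀ (k : ℕ) (V : Fin k → Set X),
      (∀ x, ({i | x ∈ V i}).ncard ≤ 0 + 1) ↔ Pairwise (Disjoint on V) := by
    intro k V
    constructor
    · intro h i j hij
      refine disjoint_left.2 fun x hi hj => hij ?_
      exact (ncard_le_one (toFinite _)).1 (h x) i hi j hj
    · intro h x
      refine (ncard_le_one (toFinite _)).2 fun i hi j hj => ?_
      by_contra hij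
      exact disjoint_left.1 (h hij) hi hj
  simp only [DimLE, key]

/-- The covering dimension does not increase when passing to closed subspaces. -/
theorem DimLE.of_isClosedEmbedding {A : Type*} [TopologicalSpace A] {n : ℕ} (h : DimLE X n)
    {f : A → X} (hf : IsClosedEmbedding f) : DimLE A n := by
  intro k U hU hcov
  rcases isEmpty_or_nonempty A with hA | ⟨⟨a⟩⟩
  · exact ⟨U, hU, fun _ => Subset.rfl, hcov, fun x => isEmptyElim x⟩
  choose U' hU' hUU' using fun i => hf.isInducing.isOpen_iff.1 (hU i)
  obtain ⟨i₀, -⟩ := mem_iUnion.1 (hcov.symm ▸ mem_univ a : a ∈ ⋃ i, U i)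
  obtain ⟨V, hV, hVU, hVcov, hord⟩ := h k (fun i => U' i ∪ (range f)ᶜ)
    (fun i => (hU' i).union hf.isClosed_range.isOpen_compl) (by
      refine eq_univ_of_forall fun x => mem_iUnion.2 ?_
      by_cases hx : x ∈ range f
      · obtain ⟨b, rfl⟩ := hx
        obtain ⟨i, hi⟩ := mem_iUnion.1 (hcov.symm ▸ mem_univ b : b ∈ ⋃ i, U i)
        rw [← hUU' i] at hi
        exact ⟨i, Or.inl hi⟩
      · exact ⟨i₀, Or.inr hx⟩)
  refine ⟨fun i => f ⁻¹' V i, fun i => (hV i).preimage hf.continuous, fun i b hb => ?_, ?_,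
    fun b => hord (f b)⟩
  · rw [← hUU' i]
    exact (hVU i hb).resolve_right fun hn => hn (mem_range_self b)
  · rw [← preimage_iUnion, hVcov, preimage_univ]

theorem DimLE.exists_isClopen_subset [T1Space X] (h : DimLE X 0) {x : X} {W : Set X}
    (hW : IsOpen W) (hx : x ∈ W) : ∃ A, IsClopen A ∧ x ∈ A ∧ A ⊆ W := by
  obtain ⟨V, hV, hVU, hcov, hd⟩ := dimLE_zero_iff.1 h 2 ![W, {x}ᶜ]
    (by simp [Fin.forall_fin_two, hW])
    (by
      refine eq_univ_of_forall fun y => mem_iUnion.2 ?_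
      by_cases hy : y = x
      · exact ⟨0, by simpa [hy] using hx⟩
      · exact ⟨1, by simpa using hy⟩)
  have hcov' : ∀ y, y ∈ V 0 ∨ y ∈ V 1 := fun y => by
    obtain ⟨i, hi⟩ := mem_iUnion.1 (hcov.symm ▸ mem_univ y : y ∈ ⋃ i, V i)
    fin_cases i
    exacts [Or.inl hi, Or.inr hi]
  have hd01 : Disjoint (V 0) (V 1) := hd (by decide)
  have hcompl : (V 0)ᶜ = V 1 := by
    ext y
    exact ⟨fun hy => (hcov' y).resolve_left hy, fun hy hy' => disjoint_left.1 hd01 hy' hy⟩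
  refine ⟨V 0, ⟨⟨hcompl ▸ hV 1⟩, hV 0⟩, (hcov' x).resolve_right fun hx1 => ?_, hVU 0⟩
  exact hVU 1 hx1 rfl

/-- In a Lindelöf space, clopen-local disjoint shrinkings of covers can be glued. -/
theorem dimLE_zero_of_local [LindelofSpace X]
    (H : ∀ (k : ℕ) (U : Fin k → Set X), (∀ i, IsOpen (U i)) → (⋃ i, U i) = univ →
      ∀ x : X, ∃ A : Set X, IsClopen A ∧ x ∈ A ∧ ∃ V : Fin k → Set X, (∀ i, IsOpen (V i)) ∧
        (∀ i, A ∩ V i ⊆ U i) ∧ A ⊆ ⋃ i, V i ∧ Pairwise (Disjoint on V)) :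
    DimLE X 0 := by
  refine dimLE_zero_iff.2 fun k U hU hcov => ?_
  rcases isEmpty_or_nonempty X with hX | hX
  · exact ⟨U, hU, fun _ => Subset.rfl, hcov, fun i j _ => disjoint_left.2 fun x => isEmptyElim x⟩
  choose A hA hxA V hV hVU hAV hd using H k U hU hcov
  obtain ⟨t, htc, ht⟩ := LindelofSpace.elim_nhds_subcover A fun x => (hA x).isOpen.mem_nhds (hxA x)
  have htne : t.Nonempty := by
    by_contra hne
    rw [not_nonempty_iff_eq_empty] at hne
    subst hne
    rw [biUnion_empty] at ht
    exact empty_ne_univ ht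
  obtain ⟨s, rfl⟩ := htc.exists_eq_range htne
  rw [biUnion_range] at ht
  let D := disjointed fun n => A (s n)
  have hDA : ∀ n, D n ⊆ A (s n) := fun n => disjointed_subset _ n
  have hD : ∀ n, IsOpen (D n) := fun n =>
    disjointedRec (p := IsOpen) (fun _ _ ht => IsOpen.sdiff ht (hA _).isClosed) (hA (s n)).isOpen
  have hDd : Pairwise (Disjoint on D) := disjoint_disjointed _
  have hDcov : ⋃ n, D n = univ := by rw [← ht]; exact iUnion_disjointed
  refine ⟨fun i => ⋃ n, D n ∩ V (s n) i, fun i => isOpen_iUnion fun n => (hD n).inter (hV _ _),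
    fun i => iUnion_subset fun n => (inter_subset_inter_left _ (hDA n)).trans (hVU _ _), ?_, ?_⟩
  · refine eq_univ_of_forall fun x => ?_
    obtain ⟨n, hn⟩ := mem_iUnion.1 (hDcov.symm ▸ mem_univ x : x ∈ ⋃ n, D n)
    obtain ⟨i, hi⟩ := mem_iUnion.1 (hAV _ (hDA n hn))
    exact mem_iUnion.2 ⟨i, mem_iUnion.2 ⟨n, hn, hi⟩⟩
  · intro i j hij
    refine disjoint_left.2 fun x hi hj => ?_
    obtain ⟨n, hn, hni⟩ := mem_iUnion.1 hi
    obtain ⟨m, hm, hmj⟩ := mem_iUnion.1 hj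
    have hnm : n = m := by
      by_contra hne
      exact disjoint_left.1 (hDd hne) hn hm
    subst hnm
    exact disjoint_left.1 (hd (s n) hij) hni hmj

/-- A compact Hausdorff space whose points are separated by clopen sets is zero-dimensional. -/
theorem dimLE_zero_of_totallySeparatedSpace [CompactSpace X] [T2Space X]
    [TotallySeparatedSpace X] : DimLE X 0 := by
  refine dimLE_zero_of_local fun k U hU hcov x => ?_
  obtain ⟨i, hi⟩ := mem_iUnion.1 (hcov.symm ▸ mem_univ x : x ∈ ⋃ i, U i)
  obtain ⟨A, hA, hxA, hAU⟩ := compact_exists_isClopen_in_isOpen (hU i) hi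
  refine ⟨A, hA, hxA, fun j => {y | j = i}, fun j => isOpen_const, ?_,
    fun y hy => mem_iUnion.2 ⟨i, rfl⟩, ?_⟩
  · rintro j y ⟨hy, rfl⟩
    exact hAU hy
  · rintro j l hjl
    refine disjoint_left.2 fun y hj hl => hjl (hj.trans hl.symm)

end ZeroDimensional

section Sections

variable {Z K : Type*} [TopologicalSpace Z] [TopologicalSpace K]

theorem isClosed_section {X : Set (Z × K)} (hX : IsClosed X) (z : Z) :
    IsClosed {y : K | (z, y) ∈ X} :=
  hX.preimage (by fun_prop : Continuous fun y : K => (z, y))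

theorem DimLE.verticalSection [T1Space Z] {X : Set (Z × K)} {n : ℕ} (h : DimLE X n) (z : Z) :
    DimLE {y : K | (z, y) ∈ X} n := by
  have hemb : IsEmbedding fun y : {y : K | (z, y) ∈ X} => (⟨(z, y.1), y.2⟩ : X) := by
    refine IsEmbedding.of_comp (by fun_prop) continuous_subtype_val ?_
    exact (isEmbedding_prodMkRight z).comp IsEmbedding.subtypeVal
  refine h.of_isClosedEmbedding ⟨hemb, ?_⟩
  have : range (fun y : {y : K | (z, y) ∈ X} => (⟨(z, y.1), y.2⟩ : X))
      = (fun p : X => p.1.1) ⁻¹' {z} := by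
    ext ⟨⟨w, y⟩, hp⟩
    constructor
    · rintro ⟨y', hy'⟩
      simp only [Subtype.mk.injEq, Prod.mk.injEq] at hy'
      exact hy'.1.symm
    · rintro rfl
      exact ⟨⟨y, hp⟩, rfl⟩
  rw [this]
  exact isClosed_singleton.preimage (by fun_prop)

/-- A closed subset of `Z × K` with `Z` zero-dimensional and `K` compact is zero-dimensional
as soon as all its vertical sections are. -/
theorem dimLE_zero_of_sections [T1Space Z] (hZ : DimLE Z 0) [CompactSpace K] [T2Space K]
    {X : Set (Z × K)} [LindelofSpace X] (hX : IsClosed X)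
    (h : ∀ z, DimLE {y : K | (z, y) ∈ X} 0) : DimLE X 0 := by
  refine dimLE_zero_of_local fun k U hU hcov x => ?_
  obtain ⟨⟨z, y₀⟩, hx⟩ := x
  choose U' hU' hUU' using fun i => isOpen_induced_iff.1 (hU i)
  have hSc : CompactSpace {y : K | (z, y) ∈ X} :=
    isCompact_iff_compactSpace.1 (isClosed_section hX z).isCompact
  have hmk : Continuous fun y : {y : K | (z, y) ∈ X} => (⟨(z, y.1), y.2⟩ : X) := by fun_prop
  obtain ⟨V, hV, hVU, hVcov, hVd⟩ := dimLE_zero_iff.1 (h z) k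
    (fun i => (fun y : {y : K | (z, y) ∈ X} => (⟨(z, y.1), y.2⟩ : X)) ⁻¹' U i)
    (fun i => (hU i).preimage hmk) (by rw [← preimage_iUnion, hcov, preimage_univ])
  have hVcl : ∀ i, IsClosed (V i) := by
    intro i
    have : (V i)ᶜ = ⋃ j ∈ {j | j ≠ i}, V j := by
      ext y
      simp only [mem_iUnion, exists_prop]
      constructor
      · intro hy
        obtain ⟨j, hj⟩ := mem_iUnion.1 (hVcov.symm ▸ mem_univ y : y ∈ ⋃ j, V j)
        exact ⟨j, fun hji => hy (hji ▸ hj), hj⟩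
      · rintro ⟨j, hji, hj⟩ hy
        exact disjoint_left.1 (hVd hji) hj hy
    exact ⟨this ▸ isOpen_biUnion fun j _ => hV j⟩
  let C : Fin k → Set K := fun i => Subtype.val '' V i
  have hC : ∀ i, IsCompact (C i) := fun i => (hVcl i).isCompact.image continuous_subtype_val
  have hCd : Pairwise (Disjoint on fun i => 𝓝ˢ (C i)) := by
    intro i j hij
    refine (SeparatedNhds.of_isCompact_isCompact (hC i) (hC j) ?_).disjoint_nhdsSet
    exact (disjoint_image_iff Subtype.val_injective).2 (hVd hij)
  obtain ⟨N, hN, hNd⟩ := hCd.exists_mem_filter_of_disjoint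
  have hCU : ∀ i, {z} ×ˢ C i ⊆ U' i := by
    rintro i ⟨w, _⟩ ⟨hw, y, hy, rfl⟩
    obtain rfl : w = z := hw
    have := hVU i hy
    rw [mem_preimage, ← hUU' i] at this
    exact this
  choose W P hW hP hzW hCP hWP using fun i =>
    generalized_tube_lemma isCompact_singleton (hC i) (hU' i) (hCU i)
  let O : Fin k → Set K := fun i => interior (N i) ∩ P i
  have hO : ∀ i, IsOpen (O i) := fun i => isOpen_interior.inter (hP i)
  have hCO : ∀ i, C i ⊆ O i := fun i =>
    subset_inter (subset_interior_iff_mem_nhdsSet.2 (hN i)) (hCP i)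
  obtain ⟨W', Q, hW', -, hzW', hQ, hWQ⟩ := generalized_tube_lemma (isCompact_singleton (x := z))
    (isOpen_iUnion hO).isClosed_compl.isCompact hX.isOpen_compl (by
      rintro ⟨_, y⟩ ⟨rfl, hy⟩ hyX
      obtain ⟨i, hi⟩ := mem_iUnion.1 (hVcov.ge (mem_univ ⟨y, hyX⟩))
      exact hy (mem_iUnion.2 ⟨i, hCO i ⟨_, hi, rfl⟩⟩))
  obtain ⟨A, hA, hzA, hAW⟩ := hZ.exists_isClopen_subset (x := z) (W := W' ∩ ⋂ i, W i)
    (hW'.inter (isOpen_iInter_of_finite hW))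
    ⟨hzW' rfl, mem_iInter.2 fun i => hzW i rfl⟩
  refine ⟨(fun p : X => p.1.1) ⁻¹' A, hA.preimage (by fun_prop), hzA,
    fun i => (fun p : X => p.1.2) ⁻¹' O i, fun i => (hO i).preimage (by fun_prop), ?_, ?_, ?_⟩
  · rintro i p ⟨hpA, hpO⟩
    rw [← hUU' i]
    exact hWP i ⟨mem_iInter.1 (hAW hpA).2 i, hpO.2⟩
  · intro p hpA
    by_contra hp
    rw [← preimage_iUnion] at hp
    exact hWQ (show p.1 ∈ W' ×ˢ Q from ⟨(hAW hpA).1, hQ hp⟩) p.2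
  · intro i j hij
    exact ((hNd hij).mono (inter_subset_left.trans interior_subset)
      (inter_subset_left.trans interior_subset)).preimage _

end Sections

section Hyperspace

theorem vietoris_eq (Y : Type*) [TopologicalSpace Y] :
    vietoris Y = TopologicalSpace.vietoris Y := by
  refine congrArg generateFrom (congrArg₂ _ ?_ ?_)
  · ext S
    exact ⟨fun ⟨U, hU, hS⟩ => ⟨U, hU, hS.symm⟩, fun ⟨U, hU, hS⟩ => ⟨U, hU, hS.symm⟩⟩
  · ext S
    exact ⟨fun ⟨U, hU, hS⟩ => ⟨U, hU, hS.symm⟩, fun ⟨U, hU, hS⟩ => ⟨U, hU, hS.symm⟩⟩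

variable {X Y : Type*} [TopologicalSpace X] [TopologicalSpace Y] [CompactSpace Y]

theorem secondCountableTopology_induced_vietoris [SecondCountableTopology Y] (e : X → Y) :
    @SecondCountableTopology (Cl X)
      ((vietoris Y).induced fun F : Cl X => closure (e '' F.1)) := by
  have : (vietoris Y).induced (fun F : Cl X => closure (e '' F.1)) =
      (inferInstance : TopologicalSpace (Compacts Y)).induced
        (fun F : Cl X => ⟨closure (e '' F.1), isClosed_closure.isCompact⟩) := by
    rw [vietoris_eq]
    exact (induced_compose (f := fun F : Cl X =>
      (⟨closure (e '' F.1), isClosed_closure.isCompact⟩ : Compacts Y)) (g := SetLike.coe)).symm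
  rw [this]
  exact secondCountableTopology_induced _ _ _

/-- Taking the closure of a countable family of points is a Borel operation with respect to the
Vietoris topology of a metrizable compactification. -/
theorem measurable_closure_range [MetrizableSpace Y] {W ι : Type*} [Countable ι]
    [TopologicalSpace W] [MeasurableSpace W] [BorelSpace W] {e : X → Y} (he : Continuous e)
    {s : ι → W → X} (hs : ∀ i, Continuous (s i)) :
    @Measurable W (Cl X) _ (@borel _ ((vietoris Y).induced fun F : Cl X => closure (e '' F.1)))
      fun w => ⟨closure (range fun i => s i w), isClosed_closure⟩ := by
  let := metrizableSpaceMetric Y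
  have hcl : ∀ w, closure (e '' closure (range fun i => s i w)) =
      closure (range fun i => e (s i w)) := fun w => by
    rw [closure_image_closure he, ← range_comp]
    rfl
  let τ : TopologicalSpace (Cl X) := (vietoris Y).induced fun F : Cl X => closure (e '' F.1)
  have : SecondCountableTopology (Cl X) := secondCountableTopology_induced_vietoris e
  rw [borel_eq_generateFrom_of_subbasis (t := τ) induced_generateFrom_eq]
  refine measurable_generateFrom ?_
  rintro _ ⟨_, ⟨U, hU, rfl⟩ | ⟨U, hU, rfl⟩, rfl⟩
  · have : (fun w => (⟨closure (range fun i => s i w), isClosed_closure⟩ : Cl X)) ⁻¹'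
        ((fun F : Cl X => closure (e '' F.1)) ⁻¹' {A | A ⊆ U}) =
        ⋃ n : ℕ, ⋂ i, (fun w => Metric.infEDist (e (s i w)) Uᶜ) ⁻¹' Ici ((n : ENNReal)⁻¹) := by
      ext w
      simp only [mem_preimage, mem_ofPred_eq, hcl, mem_iUnion, mem_iInter, mem_Ici]
      constructor
      · intro h
        obtain ⟨δ, hδ, hsub⟩ := isClosed_closure.isCompact.exists_thickening_subset_open hU h
        obtain ⟨n, hn⟩ := ENNReal.exists_inv_nat_lt (ENNReal.ofReal_pos.2 hδ).ne'
        refine ⟨n, fun i => hn.le.trans (Metric.le_infEDist.2 fun y hy => ?_)⟩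
        by_contra! hlt
        refine hy (hsub (Metric.mem_thickening_iff.2 ⟨_, subset_closure ⟨i, rfl⟩, ?_⟩))
        rw [edist_comm, edist_dist, ENNReal.ofReal_lt_ofReal_iff hδ] at hlt
        exact hlt
      · rintro ⟨n, hn⟩
        have : closure (range fun i => e (s i w)) ⊆
            (fun y => Metric.infEDist y Uᶜ) ⁻¹' Ici ((n : ENNReal)⁻¹) :=
          closure_minimal (range_subset_iff.2 hn) (isClosed_Ici.preimage Metric.continuous_infEDist)
        intro y hy
        by_contra hyU
        have h0 := this hy
        rw [mem_preimage, Metric.infEDist_zero_of_mem hyU, mem_Ici] at h0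
        exact absurd h0 (not_le.2 (ENNReal.inv_pos.2 (ENNReal.natCast_ne_top n)))
    rw [this]
    exact .iUnion fun n => .iInter fun i => (isClosed_Ici.preimage
      (Metric.continuous_infEDist.comp (he.comp (hs i)))).measurableSet
  · have : (fun w => (⟨closure (range fun i => s i w), isClosed_closure⟩ : Cl X)) ⁻¹'
        ((fun F : Cl X => closure (e '' F.1)) ⁻¹' {A | (A ∩ U).Nonempty}) =
        ⋃ i, (fun w => e (s i w)) ⁻¹' U := by
      ext w
      simp only [mem_preimage, mem_ofPred_eq, hcl, mem_iUnion, closure_inter_open_nonempty_iff hU]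
      exact ⟨fun ⟨_, ⟨i, rfl⟩, hi⟩ => ⟨i, hi⟩, fun ⟨i, hi⟩ => ⟨_, ⟨i, rfl⟩, hi⟩⟩
    rw [this]
    exact .iUnion fun i => (hU.preimage (he.comp (hs i))).measurableSet

end Hyperspace

section NotSeparated

variable {K : Type*} [TopologicalSpace K] [CompactSpace K] [MetrizableSpace K]

/-- Sequences whose first two terms are distinct and lie in the same quasi-component of the
closure of the sequence. -/
def quasiConnectedSeq (K : Type*) [TopologicalSpace K] [CompactSpace K] [MetrizableSpace K] :
    Set (ℕ → K) :=
  {c | c 0 ≠ c 1 ∧ ∀ k, denseSeq C(K, ℝ) k (c 0) < -1 → 1 < denseSeq C(K, ℝ) k (c 1) →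
    ∃ n, denseSeq C(K, ℝ) k (c n) ∈ Icc (-1) 1}

theorem measurableSet_quasiConnectedSeq_preimage {W : Type*} [TopologicalSpace W]
    [MeasurableSpace W] [BorelSpace W] {c : W → ℕ → K} (hc : Continuous c) :
    MeasurableSet (c ⁻¹' quasiConnectedSeq K) := by
  have hf : ∀ k n, Continuous fun w => denseSeq C(K, ℝ) k (c w n) := fun k n => by fun_prop
  have : c ⁻¹' quasiConnectedSeq K = {w | c w 0 = c w 1}ᶜ ∩ ⋂ k,
      (((fun w => denseSeq C(K, ℝ) k (c w 0)) ⁻¹' Iio (-1))ᶜ ∪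
        (((fun w => denseSeq C(K, ℝ) k (c w 1)) ⁻¹' Ioi 1)ᶜ ∪
          ⋃ n, (fun w => denseSeq C(K, ℝ) k (c w n)) ⁻¹' Icc (-1) 1)) := by
    ext w
    simp only [quasiConnectedSeq, mem_preimage, mem_ofPred_eq, mem_inter_iff, mem_compl_iff,
      mem_iInter, mem_union, mem_iUnion, mem_Iio, mem_Ioi, ne_eq, imp_iff_not_or]
  rw [this]
  refine .inter (isClosed_eq (by fun_prop) (by fun_prop)).measurableSet.compl (.iInter fun k => ?_)
  exact (isOpen_Iio.preimage (hf k 0)).measurableSet.compl.union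
    ((isOpen_Ioi.preimage (hf k 1)).measurableSet.compl.union
      (.iUnion fun n => (isClosed_Icc.preimage (hf k n)).measurableSet))

theorem not_dimLE_zero_of_mem_quasiConnectedSeq {C : Set K} (hC : IsClosed C) {c : ℕ → K}
    (hc : c ∈ quasiConnectedSeq K) (hcC : ∀ n, c n ∈ C) : ¬ DimLE C 0 := by
  intro h
  obtain ⟨A, hA, h0, h1⟩ := h.exists_isClopen_subset (x := ⟨c 0, hcC 0⟩)
    (W := {⟨c 1, hcC 1⟩}ᶜ) isOpen_compl_singleton (fun h => hc.1 (congrArg Subtype.val h))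
  obtain ⟨f, hf0, hf1, -⟩ := exists_continuous_zero_one_of_isClosed
    (hC.isClosedEmbedding_subtypeVal.isClosedMap _ hA.isClosed)
    (hC.isClosedEmbedding_subtypeVal.isClosedMap _ hA.compl.isClosed)
    ((disjoint_image_iff Subtype.val_injective).2 disjoint_compl_right)
  let g : C(K, ℝ) := (4 : ℝ) • f - ContinuousMap.const K 2
  obtain ⟨k, hk⟩ := (denseRange_denseSeq C(K, ℝ)).exists_dist_lt g one_pos
  have hgk : ∀ y, |g y - denseSeq C(K, ℝ) k y| < 1 := fun y =>
    (ContinuousMap.dist_apply_le_dist y).trans_lt hk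
  have hlow : ∀ y : C, y ∈ A → denseSeq C(K, ℝ) k y < -1 := fun y hy => by
    have h1 : f y = 0 := hf0 ⟨y, hy, rfl⟩
    have h2 : g y = 4 * f y - 2 := rfl
    have := abs_lt.1 (hgk y)
    linarith
  have hhigh : ∀ y : C, y ∉ A → 1 < denseSeq C(K, ℝ) k y := fun y hy => by
    have h1 : f y = 1 := hf1 ⟨y, hy, rfl⟩
    have h2 : g y = 4 * f y - 2 := rfl
    have := abs_lt.1 (hgk y)
    linarith
  obtain ⟨n, hn⟩ := hc.2 k (hlow _ h0) (hhigh _ fun h => h1 h rfl)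
  by_cases hnA : (⟨c n, hcC n⟩ : C) ∈ A
  · exact absurd (hlow _ hnA) (not_lt.2 hn.1)
  · exact absurd (hhigh _ hnA) (not_lt.2 hn.2)

theorem exists_mem_quasiConnectedSeq {C : Set K} (hC : IsClosed C) (h : ¬ DimLE C 0) :
    ∃ c ∈ quasiConnectedSeq K, ∀ n, c n ∈ C := by
  have : CompactSpace C := isCompact_iff_compactSpace.1 hC.isCompact
  have hsep : ¬ TotallySeparatedSpace C := fun _ => h dimLE_zero_of_totallySeparatedSpace
  rw [totallySeparatedSpace_iff_exists_isClopen] at hsep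
  simp only [Pairwise] at hsep
  push Not at hsep
  obtain ⟨a, b, hab, hcl⟩ := hsep
  have : Nonempty C := ⟨a⟩
  let d : ℕ → C := fun n => n.casesOn a fun n => n.casesOn b fun n => denseSeq C n
  have hd : DenseRange d := (denseRange_denseSeq C).mono
    (range_subset_iff.2 fun n => ⟨n + 2, rfl⟩)
  let c : ℕ → K := fun n => (d n).1
  refine ⟨c, ⟨fun h => hab (Subtype.ext h), fun k h0 h1 => ?_⟩, fun n => (d n).2⟩
  by_contra! hn
  have hf : Continuous fun y : C => denseSeq C(K, ℝ) k y := by fun_prop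
  have hall : ∀ y : C, denseSeq C(K, ℝ) k y ∈ Iic (-1 : ℝ) ∪ Ici 1 := fun y => by
    refine hd.induction_on (p := fun y : C => denseSeq C(K, ℝ) k y ∈ Iic (-1 : ℝ) ∪ Ici 1) y
      ((isClosed_Iic.union isClosed_Ici).preimage hf) fun n => ?_
    have := hn n
    simp only [mem_Icc, not_and_or, not_le] at this
    exact this.imp le_of_lt le_of_lt
  have hclopen : IsClopen ((fun y : C => denseSeq C(K, ℝ) k y) ⁻¹' Iio 0) := by
    refine ⟨?_, isOpen_Iio.preimage hf⟩
    convert isClosed_Iic (a := (-1 : ℝ)).preimage hf using 1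
    ext y
    rcases hall y with hy | hy <;> simp only [mem_preimage, mem_Iio, mem_Iic, mem_Ici] at hy ⊢ <;>
      constructor <;> intro <;> linarith
  have h0' : denseSeq C(K, ℝ) k a < -1 := h0
  have h1' : 1 < denseSeq C(K, ℝ) k b := h1
  refine hcl _ hclopen (show denseSeq C(K, ℝ) k a < 0 by linarith) ?_
  exact show ¬ denseSeq C(K, ℝ) k b < 0 by linarith

end NotSeparated

section Coanalytic

variable {Z K : Type*} [TopologicalSpace Z] [MetrizableSpace Z] [SeparableSpace Z]
  [TopologicalSpace K] [CompactSpace K] [MetrizableSpace K]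

theorem secondCountableTopology_of_separable_metrizable (Z : Type*) [TopologicalSpace Z]
    [MetrizableSpace Z] [SeparableSpace Z] : SecondCountableTopology Z := by
  let := metrizableSpaceMetric Z
  exact UniformSpace.secondCountable_of_separable Z

theorem dimLE_zero_iff_sections (hZ : DimLE Z 0) {X : Set (Z × K)} (hX : IsClosed X) :
    DimLE X 0 ↔ ∀ z : Z, DimLE {y : K | (z, y) ∈ X} 0 := by
  have := secondCountableTopology_of_separable_metrizable Z
  exact ⟨DimLE.verticalSection, dimLE_zero_of_sections hZ hX⟩

theorem mem_F0_iff (hZ : DimLE Z 0) {X : Set (Z × K)} (hX : IsClosed X) (F : Cl X) :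
    F ∈ F0 X ↔ ∀ z : Z, DimLE {y : K | (z, y) ∈ Subtype.val '' F.1} 0 := by
  rw [← dimLE_zero_iff_sections hZ (hX.isClosedEmbedding_subtypeVal.isClosedMap _ F.2)]
  have e : F.1 ≃ₜ (Subtype.val '' F.1 : Set (Z × K)) :=
    IsEmbedding.subtypeVal.homeomorphImage F.1
  exact ⟨fun h => h.of_isClosedEmbedding e.symm.isClosedEmbedding,
    fun h => h.of_isClosedEmbedding e.isClosedEmbedding⟩

theorem analyticSet_compl_F0 (hZ : DimLE Z 0) {X : Set (Z × K)} (hX : IsClosed X)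
    {g : (ℕ → ℕ) → Z} (hg : Continuous g) (hgs : Function.Surjective g)
    {τ : TopologicalSpace (Cl X)} (hτ : IsAdmissible X τ) :
    @MeasureTheory.AnalyticSet _ τ (F0 X)ᶜ := by
  obtain ⟨Y, _, _, _, e, he, rfl⟩ := hτ
  have := secondCountableTopology_of_separable_metrizable Z
  have : PolishSpace K := by
    let := metrizableSpaceMetric K
    infer_instance
  -- codes for points of `X`, and for sequences contained in a single section of `X`
  let P := {q : (ℕ → ℕ) × K | (g q.1, q.2) ∈ X}
  let Q := {q : (ℕ → ℕ) × (ℕ → K) | ∀ n, (g q.1, q.2 n) ∈ X}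
  have hP : IsClosed P := hX.preimage (by fun_prop : Continuous fun q : (ℕ → ℕ) × K => (g q.1, q.2))
  have hQ : IsClosed Q := by
    simp only [Q, ofPred_forall]
    exact isClosed_iInter fun n =>
      hX.preimage (by fun_prop : Continuous fun q : (ℕ → ℕ) × (ℕ → K) => (g q.1, q.2 n))
  have : PolishSpace P := hP.polishSpace
  have : PolishSpace Q := hQ.polishSpace
  let W := (ℕ → P) × Q
  have : PolishSpace W := inferInstanceAs (PolishSpace ((ℕ → P) × Q))
  let : MeasurableSpace W := borel W
  have : BorelSpace W := ⟨rfl⟩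
  let s : ℕ ⊕ ℕ → W → X := fun i w => i.elim
    (fun n => ⟨(g (w.1 n).1.1, (w.1 n).1.2), (w.1 n).2⟩)
    (fun n => ⟨(g w.2.1.1, w.2.1.2 n), w.2.2 n⟩)
  have hs : ∀ i, Continuous (s i) := by
    rintro (n | n)
    · exact Continuous.subtype_mk (by fun_prop : Continuous fun w : (ℕ → P) × Q =>
        (g (w.1 n).1.1, (w.1 n).1.2)) _
    · exact Continuous.subtype_mk (by fun_prop : Continuous fun w : (ℕ → P) × Q =>
        (g w.2.1.1, w.2.1.2 n)) _
  let Φ : W → Cl X := fun w => ⟨closure (range fun i => s i w), isClosed_closure⟩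
  have hS : MeasurableSet ((fun w : W => w.2.1.2) ⁻¹' quasiConnectedSeq K) :=
    measurableSet_quasiConnectedSeq_preimage
      (by fun_prop : Continuous fun w : (ℕ → P) × Q => w.2.1.2)
  have himage : (F0 X)ᶜ = Φ '' ((fun w : W => w.2.1.2) ⁻¹' quasiConnectedSeq K) := by
    ext F
    rw [mem_compl_iff, mem_F0_iff hZ hX]
    constructor
    · intro hF
      push Not at hF
      obtain ⟨z, hz⟩ := hF
      obtain ⟨c, hc, hcF⟩ := exists_mem_quasiConnectedSeq (isClosed_section
        (hX.isClosedEmbedding_subtypeVal.isClosedMap _ F.2) z) hz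
      obtain ⟨p, rfl⟩ := hgs z
      choose x hxF hx using hcF
      have : Nonempty F.1 := ⟨⟨x 0, hxF 0⟩⟩
      let u : ℕ → F.1 := denseSeq F.1
      choose q hq using fun n => hgs (u n).1.1.1
      let w : W := (fun n => ⟨(q n, (u n).1.1.2), by
        show (g (q n), (u n).1.1.2) ∈ X
        rw [hq]
        exact (u n).1.2⟩, ⟨(p, c), fun n => by
        show (g p, c n) ∈ X
        rw [← hx n]
        exact (x n).2⟩)
      have hinl : ∀ n, s (Sum.inl n) w = (u n).1 := fun n =>
        Subtype.ext (Prod.ext (hq n) rfl)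
      have hinr : ∀ n, s (Sum.inr n) w = x n := fun n => Subtype.ext (hx n).symm
      refine ⟨w, hc, Subtype.ext (Subset.antisymm ?_ ?_)⟩
      · refine closure_minimal (range_subset_iff.2 ?_) F.2
        rintro (n | n)
        · rw [hinl]
          exact (u n).2
        · rw [hinr]
          exact hxF n
      · intro y hy
        have h1 : (⟨y, hy⟩ : F.1) ∈ closure (range u) := denseRange_denseSeq F.1 _
        refine closure_mono ?_ (closure_subtype.1 h1)
        rintro _ ⟨_, ⟨n, rfl⟩, rfl⟩
        exact ⟨Sum.inl n, hinl n⟩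
    · rintro ⟨w, hw, rfl⟩ h
      refine not_dimLE_zero_of_mem_quasiConnectedSeq (isClosed_section
        (hX.isClosedEmbedding_subtypeVal.isClosedMap _ (Φ w).2) (g w.2.1.1)) hw
        (fun n => ?_) (h (g w.2.1.1))
      exact ⟨s (Sum.inr n) w, subset_closure ⟨Sum.inr n, rfl⟩, rfl⟩
  let τ : TopologicalSpace (Cl X) := (vietoris Y).induced fun F : Cl X => closure (e '' F.1)
  let : MeasurableSpace (Cl X) := borel (Cl X)
  have : BorelSpace (Cl X) := ⟨rfl⟩
  have : SecondCountableTopology (Cl X) := secondCountableTopology_induced_vietoris e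
  have hΦ : Measurable Φ := measurable_closure_range he.continuous hs
  rw [himage]
  exact hS.analyticSet_image hΦ

end Coanalytic

/-- Let `X` be a closed subset of `Z × K`, where `Z` is a zero-dimensional separable
metrizable space and `K` is a compact metrizable space. Then `dim X = 0` iff
`dim X(z) = 0` for every `z ∈ Z`. In particular, if `Z` is analytic then `F₀(X)` is
`Π¹₁` (co-analytic) in `F(X)`. -/
theorem dim_zero_iff_sections_of_closed_in_prod {Z K : Type*}
    [TopologicalSpace Z] [TopologicalSpace.MetrizableSpace Z]
    [TopologicalSpace.SeparableSpace Z] (hZ : DimLE Z 0)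
    [TopologicalSpace K] [CompactSpace K] [TopologicalSpace.MetrizableSpace K]
    (X : Set (Z × K)) (hX : IsClosed X) :
    (DimLE (↥X) 0 ↔ ∀ z : Z, DimLE (↥{y : K | (z, y) ∈ X}) 0) ∧
    (IsAnalyticSpace Z →
      ∀ τ : TopologicalSpace (Cl ↥X), IsAdmissible (↥X) τ →
        @MeasureTheory.AnalyticSet _ τ ((F0 ↥X)ᶜ)) := by
  refine ⟨dimLE_zero_iff_sections hZ hX, fun ⟨_, _, hA⟩ τ hτ => ?_⟩
  rcases hA with hE | ⟨g, hg, hgs⟩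
  · have : (F0 X)ᶜ = ∅ := by
      refine compl_empty_iff.2 (eq_univ_of_forall fun F => ?_)
      exact (mem_F0_iff hZ hX F).2 fun z => isEmptyElim z
    rw [this]
    exact @MeasureTheory.analyticSet_empty _ τ
  · exact analyticSet_compl_F0 hZ hX hg hgs hτ
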